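/- Let Λ ⊆ ℝ^{2d} be a countable relatively separated set and v a submultiplicative weight on ℝ^{2d} satisfying the GRS condition. If A ∈ C_v(Λ) and A, regarded as a bounded operator on ℓ²(Λ), is invertible, then A^{-1} ∈ C_v(Λ). -/

import Mathlib

open MeasureTheory Filter

noncomputable section

abbrev Ed (d : ℕ) := EuclideanSpace ℝ (Fin d)
abbrev E2 (d : ℕ) := EuclideanSpace ℝ (Fin d ⊕ Fin d)

def timePart {d : ℕ} (z : E2 d) : Ed d := WithLp.toLp 2 (fun i => z (Sum.inl i))
def freqPart {d : ℕ} (z : E2 d) : Ed d := WithLp.toLp 2 (fun i => z (Sum.inr i))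

def tfShift {d : ℕ} (z : E2 d) (g : Ed d → ℂ) : Ed d → ℂ :=
  fun t => Complex.exp (2 * Real.pi * Complex.I *
      (∑ i : Fin d, (freqPart z i : ℂ) * (t i : ℂ))) * g (t - timePart z)

def L2inner {d : ℕ} (f h : Ed d → ℂ) : ℂ :=
  ∫ t : Ed d, f t * (starRingEnd ℂ) (h t)

def L2normSq {d : ℕ} (f : Ed d → ℂ) : ℝ := ∫ t : Ed d, ‖f t‖ ^ 2

def gaussian (d : ℕ) : Ed d → ℂ := fun t => (Real.exp (-Real.pi * ‖t‖ ^ 2) : ℝ)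

/-- A (positive, submultiplicative) weight function. -/
structure IsWeight {d : ℕ} (v : E2 d → ℝ) : Prop where
  pos : ∀ z, 0 < v z
  submul : ∀ z w, v (z + w) ≤ v z * v w

/-- The Gelfand–Raikov–Shilov condition `lim_n v(nz)^{1/n} = 1`. -/
def SatisfiesGRS {d : ℕ} (v : E2 d → ℝ) : Prop :=
  ∀ z : E2 d, Tendsto (fun n : ℕ => Real.rpow (v ((n : ℝ) • z)) ((n : ℝ)⁻¹)) atTop (nhds 1)

/-- Subconvolutivity: `(v⁻¹ * v⁻¹)(z) ≤ C v(z)⁻¹`. -/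
def Subconvolutive {d : ℕ} (v : E2 d → ℝ) : Prop :=
  ∃ C > 0, ∀ z : E2 d,
    (∫⁻ w : E2 d, ENNReal.ofReal ((v w)⁻¹ * (v (z - w))⁻¹)) ≤ ENNReal.ofReal (C * (v z)⁻¹)

/-- A set is relatively separated if balls of radius 1 contain boundedly many points. -/
def RelativelySeparated {d : ℕ} (Λ : Set (E2 d)) : Prop :=
  ∃ N : ℕ, ∀ z : E2 d, ({l ∈ Λ | dist l z ≤ 1}).encard ≤ (N : ℕ∞)

/-- The Gabor frame inequalities with frame bounds `A, B`. -/
def GaborFrame {d : ℕ} (g : Ed d → ℂ) (Λ : Set (E2 d)) (A B : ℝ) : Prop :=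
  0 < A ∧ 0 < B ∧ ∀ f : Ed d → ℂ, MemLp f 2 (volume : Measure (Ed d)) →
    A * L2normSq f ≤ (∑' l : Λ, ‖L2inner f (tfShift (l : E2 d) g)‖ ^ 2) ∧
    (∑' l : Λ, ‖L2inner f (tfShift (l : E2 d) g)‖ ^ 2) ≤ B * L2normSq f

/-- The Bessel inequality with Bessel bound `B`. -/
def GaborBessel {d : ℕ} (g : Ed d → ℂ) (Λ : Set (E2 d)) (B : ℝ) : Prop :=
  ∀ f : Ed d → ℂ, MemLp f 2 (volume : Measure (Ed d)) →
    (∑' l : Λ, ‖L2inner f (tfShift (l : E2 d) g)‖ ^ 2) ≤ B * L2normSq f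

/-- `c` lies in the kernel of the synthesis operator `D_{g,Λ}`:  the partial sums
`∑_{λ ∈ s} c_λ π(λ) g` tend to `0` in `L²`. -/
def InSynthKernel {d : ℕ} (g : Ed d → ℂ) (Λ : Set (E2 d)) (c : Λ → ℂ) : Prop :=
  Tendsto (fun s : Finset Λ => ∫ t : Ed d, ‖∑ l ∈ s, c l * tfShift (l : E2 d) g t‖ ^ 2)
    atTop (nhds 0)

/-- A Gabor system is a Riesz basis if it is a frame and the synthesis operator has
trivial kernel on `ℓ²(Λ)`. -/
def GaborRieszBasis {d : ℕ} (g : Ed d → ℂ) (Λ : Set (E2 d)) : Prop :=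
  (∃ A B : ℝ, GaborFrame g Λ A B) ∧
  ∀ c : Λ → ℂ, Summable (fun l : Λ => ‖c l‖ ^ 2) → InSynthKernel g Λ c → ∀ l, c l = 0

/-- The lower Riesz bound `A_n` of the finite section `G(g, Λ ∩ B_n(0))`. -/
def lowerRiesz {d : ℕ} (g : Ed d → ℂ) (Λ : Set (E2 d)) (n : ℕ) : ℝ :=
  sInf { r : ℝ | ∃ (s : Finset Λ) (c : Λ → ℂ),
    (∀ l ∈ s, ‖(l : E2 d)‖ ≤ (n : ℝ)) ∧
    0 < (∑ l ∈ s, ‖c l‖ ^ 2) ∧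
    r = (∫ t : Ed d, ‖∑ l ∈ s, c l * tfShift (l : E2 d) g t‖ ^ 2) / (∑ l ∈ s, ‖c l‖ ^ 2) }

/-- Membership of `g` in the modulation space `M¹_v`. -/
def MemM1 {d : ℕ} (g : Ed d → ℂ) (v : E2 d → ℝ) : Prop :=
  ∫⁻ z : E2 d, ENNReal.ofReal (‖L2inner g (tfShift z (gaussian d))‖ * v z) < ⊤

/-- Membership of `g` in the modulation space `M^∞_v`. -/
def MemMInf {d : ℕ} (g : Ed d → ℂ) (v : E2 d → ℝ) : Prop :=
  ∃ C : ℝ, ∀ z : E2 d, ‖L2inner g (tfShift z (gaussian d))‖ * v z ≤ C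

/-- The integer lattice point `k ∈ ℤ^{2d}` as an element of `ℝ^{2d}`. -/
def intVec {d : ℕ} (k : (Fin d ⊕ Fin d) → ℤ) : E2 d := WithLp.toLp 2 (fun i => (k i : ℝ))

def unitCube (d : ℕ) : Set (E2 d) := {z | ∀ i, z i ∈ Set.Icc (0 : ℝ) 1}

/-- `sup_{z ∈ [0,1]^{2d}} |Θ(k+z)|`. -/
def cubeSup {d : ℕ} {F : Type*} [NormedAddCommGroup F] (Θ : E2 d → F)
    (k : (Fin d ⊕ Fin d) → ℤ) : ℝ :=
  sSup ((fun z => ‖Θ (intVec k + z)‖) '' unitCube d)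

/-- Membership in the Wiener amalgam space `W(C, ℓ¹_v)`. -/
def MemAmalgamW {d : ℕ} {F : Type*} [NormedAddCommGroup F] (Θ : E2 d → F)
    (v : E2 d → ℝ) : Prop :=
  Continuous Θ ∧ Summable (fun k : (Fin d ⊕ Fin d) → ℤ => cubeSup Θ k * v (intVec k))

/-- The norm of the Wiener amalgam space `W(C, ℓ¹_v)`. -/
def amalgamNorm {d : ℕ} {F : Type*} [NormedAddCommGroup F] (Θ : E2 d → F)
    (v : E2 d → ℝ) : ℝ :=
  ∑' k : (Fin d ⊕ Fin d) → ℤ, cubeSup Θ k * v (intVec k)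

/-- Convolution-dominated matrices `C_v(Λ)`. -/
def MemCv {d : ℕ} {Λ : Set (E2 d)} (A : Λ → Λ → ℂ) (v : E2 d → ℝ) : Prop :=
  ∃ Θ : E2 d → ℝ, MemAmalgamW Θ v ∧ ∀ l m : Λ, ‖A l m‖ ≤ Θ ((l : E2 d) - (m : E2 d))

/-- The norm on `C_v(Λ)`. -/
def CvNorm {d : ℕ} {Λ : Set (E2 d)} (A : Λ → Λ → ℂ) (v : E2 d → ℝ) : ℝ :=
  sInf { r : ℝ | ∃ Θ : E2 d → ℝ, MemAmalgamW Θ v ∧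
    (∀ l m : Λ, ‖A l m‖ ≤ Θ ((l : E2 d) - (m : E2 d))) ∧ r = amalgamNorm Θ v }

/-- Matrices with off-diagonal decay `v⁻¹` (the class `C_v^∞(Λ)`, Jaffard class). -/
def MemCvInf {d : ℕ} {Λ : Set (E2 d)} (A : Λ → Λ → ℂ) (v : E2 d → ℝ) : Prop :=
  ∃ C : ℝ, ∀ l m : Λ, ‖A l m‖ * v ((l : E2 d) - (m : E2 d)) ≤ C

/-- The norm on `C_v^∞(Λ)`. -/
def CvInfNorm {d : ℕ} {Λ : Set (E2 d)} (A : Λ → Λ → ℂ) (v : E2 d → ℝ) : ℝ :=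
  sSup { r : ℝ | ∃ l m : Λ, r = ‖A l m‖ * v ((l : E2 d) - (m : E2 d)) }

/-- The Gram matrix `(G_{g,Λ})_{λμ} = ⟨π(μ)g, π(λ)g⟩`. -/
def gramMatrix {d : ℕ} (g : Ed d → ℂ) (Λ : Set (E2 d)) : Λ → Λ → ℂ :=
  fun l m => L2inner (tfShift (m : E2 d) g) (tfShift (l : E2 d) g)

/-- A bounded operator `T` on `ℓ²(Λ)` is represented by the matrix `A`. -/
def Represents {d : ℕ} {Λ : Set (E2 d)}
    (T : lp (fun _ : Λ => ℂ) 2 →L[ℂ] lp (fun _ : Λ => ℂ) 2) (A : Λ → Λ → ℂ) : Prop :=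
  ∀ c : lp (fun _ : Λ => ℂ) 2, ∀ l : Λ, (T c : ∀ _ : Λ, ℂ) l = ∑' m : Λ, A l m * (c : ∀ _ : Λ, ℂ) m

/-- The standard basis vector `e_m` of `ℓ²(Λ)`. -/
def lpSingle {d : ℕ} {Λ : Set (E2 d)} (m : Λ) : lp (fun _ : Λ => ℂ) 2 :=
  haveI := Classical.decEq (↥Λ)
  lp.single 2 m (1 : ℂ)

open scoped ENNReal

/-- The `ℓ²` norm of an extended nonnegative function. -/
def ellTwo {ι : Type*} (f : ι → ℝ≥0∞) : ℝ≥0∞ := (∑' i, f i ^ 2) ^ (1 / 2 : ℝ)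

theorem ellTwo_sq {ι : Type*} (f : ι → ℝ≥0∞) : ellTwo f ^ 2 = ∑' i, f i ^ 2 := by
  rw [ellTwo, ← ENNReal.rpow_natCast, ← ENNReal.rpow_mul]
  norm_num

theorem ellTwo_mono {ι : Type*} {f g : ι → ℝ≥0∞} (h : ∀ i, f i ≤ g i) :
    ellTwo f ≤ ellTwo g := by
  unfold ellTwo
  gcongr with i
  exact h i

theorem le_ellTwo {ι : Type*} (f : ι → ℝ≥0∞) (i : ι) : f i ≤ ellTwo f := by
  refine (ENNReal.pow_le_pow_left_iff two_ne_zero).1 ?_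
  rw [ellTwo_sq]
  exact ENNReal.le_tsum (f := fun i => f i ^ 2) i

theorem tsum_mul_le_ellTwo {ι : Type*} (f g : ι → ℝ≥0∞) :
    ∑' i, f i * g i ≤ ellTwo f * ellTwo g := by
  let _ : MeasurableSpace ι := ⊤
  have h := ENNReal.lintegral_mul_le_Lp_mul_Lq (Measure.count : Measure ι)
    Real.HolderConjugate.two_two (f := f) (g := g) measurable_from_top.aemeasurable
    measurable_from_top.aemeasurable
  simpa [lintegral_count, ellTwo] using h

theorem ellTwo_le_tsum {ι κ : Type*} {f : ι → ℝ≥0∞} {F : κ → ι → ℝ≥0∞}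
    (hf : ellTwo f ≠ ∞) (h : ∀ i, f i ≤ ∑' k, F k i) :
    ellTwo f ≤ ∑' k, ellTwo (F k) := by
  by_cases h0 : ellTwo f = 0
  · simp [h0]
  refine (ENNReal.mul_le_mul_iff_right h0 hf).1 ?_
  calc ellTwo f * ellTwo f = ∑' i, f i * f i := by
        rw [← sq, ellTwo_sq]; simp only [sq]
    _ ≤ ∑' i, f i * ∑' k, F k i := by gcongr with i; exact h i
    _ = ∑' k, ∑' i, f i * F k i := by
        simp_rw [← ENNReal.tsum_mul_left]; exact ENNReal.tsum_comm
    _ ≤ ∑' k, ellTwo f * ellTwo (F k) := by gcongr with k; exact tsum_mul_le_ellTwo _ _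
    _ = _ := ENNReal.tsum_mul_left

theorem sq_tsum_mul_le {ι : Type*} (k f : ι → ℝ≥0∞) :
    (∑' i, k i * f i) ^ 2 ≤ (∑' i, k i) * ∑' i, k i * f i ^ 2 := by
  have hk : ∀ i, (k i ^ (1 / 2 : ℝ)) ^ 2 = k i := fun i => by
    rw [← ENNReal.rpow_natCast, ← ENNReal.rpow_mul]; norm_num
  have h := tsum_mul_le_ellTwo (fun i => k i ^ (1 / 2 : ℝ)) (fun i => k i ^ (1 / 2 : ℝ) * f i)
  simp_rw [← mul_assoc, ← sq, hk] at h
  calc _ ≤ _ := pow_le_pow_left' h 2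
    _ = _ := by simp_rw [mul_pow, ellTwo_sq, mul_pow, hk]

/-- Schur's test. -/
theorem ellTwo_schur {ι : Type*} {k : ι → ι → ℝ≥0∞} {R : ℝ≥0∞}
    (hrow : ∀ l, ∑' m, k l m ≤ R) (hcol : ∀ m, ∑' l, k l m ≤ R) (f : ι → ℝ≥0∞) :
    ellTwo (fun l => ∑' m, k l m * f m) ≤ R * ellTwo f := by
  refine (ENNReal.pow_le_pow_left_iff two_ne_zero).1 ?_
  rw [mul_pow, ellTwo_sq, ellTwo_sq]
  calc ∑' l, (∑' m, k l m * f m) ^ 2 ≤ ∑' l, R * ∑' m, k l m * f m ^ 2 := by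
        gcongr with l
        exact (sq_tsum_mul_le _ _).trans (by gcongr; exact hrow l)
    _ = R * ∑' m, (∑' l, k l m) * f m ^ 2 := by
        rw [ENNReal.tsum_mul_left, ENNReal.tsum_comm]; simp_rw [ENNReal.tsum_mul_right]
    _ ≤ R * ∑' m, R * f m ^ 2 := by gcongr with m; exact hcol m
    _ = _ := by rw [ENNReal.tsum_mul_left]; ring

section Renorming

variable {G : Type*} [AddCommGroup G]

/-- Almost invariance of a renormed weight under translation by one more element. -/
theorem exists_almost_invariant_weight {w : G → ℝ≥0∞}
    (hw : ∀ x y, w (x + y) ≤ w x * w y)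
    (hgrs : ∀ s : G, ∀ q : ℝ≥0∞, 1 < q → q ≠ ∞ →
      ∃ C : ℝ≥0∞, C ≠ ∞ ∧ ∀ m : ℕ, w (m • s) ≤ C * q ^ m)
    {q : ℝ≥0∞} (hq : 1 < q) (hq' : q ≠ ∞) (F : Finset G) :
    ∃ (w' : G → ℝ≥0∞) (C : ℝ≥0∞), C ≠ ∞ ∧ (∀ x, w x ≤ w' x) ∧ (∀ x, w' x ≤ C * w x) ∧
      (∀ x y, w' (x + y) ≤ w' x * w y) ∧ ∀ s ∈ F, ∀ x, w' (x + s) ≤ q * w' x := by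
  classical
  have hq0 : q ≠ 0 := (zero_lt_one.trans hq).ne'
  induction F using Finset.induction_on with
  | empty => exact ⟨w, 1, by simp, fun _ => le_rfl, by simp, hw, by simp⟩
  | insert s F _ ih =>
    obtain ⟨w', C, hC, h1, h2, h3, h4⟩ := ih
    obtain ⟨D, hD, hDs⟩ := hgrs s q hq hq'
    refine ⟨fun x => ⨆ m : ℕ, w' (x + m • s) * (q ^ m)⁻¹, C * D, ENNReal.mul_ne_top hC hD,
      fun x => ?_, fun x => ?_, fun x y => ?_, fun t ht x => ?_⟩
    · refine le_trans ?_ (le_iSup _ 0)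
      simpa using h1 x
    · refine iSup_le fun m => ?_
      calc w' (x + m • s) * (q ^ m)⁻¹ ≤ (C * w x * (D * q ^ m)) * (q ^ m)⁻¹ := by
            gcongr
            exact (h3 _ _).trans (mul_le_mul' (h2 x) (hDs m))
        _ = C * D * w x * (q ^ m * (q ^ m)⁻¹) := by ring
        _ = _ := by
            rw [ENNReal.mul_inv_cancel (pow_ne_zero _ hq0) (ENNReal.pow_ne_top hq'), mul_one]
    · refine iSup_le fun m => ?_
      calc w' (x + y + m • s) * (q ^ m)⁻¹ ≤ (w' (x + m • s) * w y) * (q ^ m)⁻¹ := by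
            gcongr
            rw [add_right_comm]
            exact h3 _ _
        _ = (w' (x + m • s) * (q ^ m)⁻¹) * w y := by ring
        _ ≤ _ := by
            gcongr
            exact le_iSup (fun m : ℕ => w' (x + m • s) * (q ^ m)⁻¹) m
    · refine iSup_le fun m => ?_
      rcases Finset.mem_insert.1 ht with rfl | ht
      · calc w' (x + t + m • t) * (q ^ m)⁻¹
              = q * (w' (x + (m + 1) • t) * (q ^ (m + 1))⁻¹) := by
              have hm : x + t + m • t = x + (m + 1) • t := by rw [succ_nsmul']; abel
              rw [hm, pow_succ, ENNReal.mul_inv (Or.inr hq') (Or.inr hq0)]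
              calc _ = (q * q⁻¹) * (w' (x + (m + 1) • t) * (q ^ m)⁻¹) := by
                    rw [ENNReal.mul_inv_cancel hq0 hq', one_mul]
                _ = _ := by ring
          _ ≤ _ := by
              gcongr
              exact le_iSup (fun m : ℕ => w' (x + m • t) * (q ^ m)⁻¹) (m + 1)
      · calc w' (x + t + m • s) * (q ^ m)⁻¹ ≤ (q * w' (x + m • s)) * (q ^ m)⁻¹ := by
              gcongr
              rw [add_right_comm]
              exact h4 t ht _
          _ = q * (w' (x + m • s) * (q ^ m)⁻¹) := by ring
          _ ≤ _ := by
              gcongr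
              exact le_iSup (fun m : ℕ => w' (x + m • s) * (q ^ m)⁻¹) m

/-- Convolution by `H` contracts a suitable weighted `ℓ¹` norm equivalent to the given one. -/
theorem exists_contracting_weight {w : G → ℝ≥0∞}
    (hw : ∀ x y, w (x + y) ≤ w x * w y)
    (hgrs : ∀ s : G, ∀ q : ℝ≥0∞, 1 < q → q ≠ ∞ →
      ∃ C : ℝ≥0∞, C ≠ ∞ ∧ ∀ m : ℕ, w (m • s) ≤ C * q ^ m)
    {H : G → ℝ≥0∞} (hH : ∑' x, H x < 1) (hHw : ∑' x, H x * w x ≠ ∞) :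
    ∃ (w' : G → ℝ≥0∞) (C Q : ℝ≥0∞), C ≠ ∞ ∧ Q < 1 ∧ (∀ x, w x ≤ w' x) ∧
      (∀ x, w' x ≤ C * w x) ∧
      ∀ g : G → ℝ≥0∞, ∑' x, (∑' y, H (x - y) * g y) * w' x ≤ Q * ∑' x, g x * w' x := by
  classical
  obtain ⟨r, hr, hr1⟩ := exists_between hH
  have hr0 : r ≠ 0 := (zero_le.trans_lt hr).ne'
  obtain ⟨r', hr', hr1'⟩ := exists_between hr1
  have htail := ENNReal.tendsto_tsum_compl_atTop_zero hHw
  have hpos : 0 < 1 - r' := tsub_pos_of_lt hr1'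
  obtain ⟨F, hF⟩ := (htail.eventually (gt_mem_nhds hpos)).exists
  have hrt : r ≠ ∞ := (hr1.trans ENNReal.one_lt_top).ne
  have hq : 1 < r' / r := by
    rw [ENNReal.lt_div_iff_mul_lt (Or.inl hr0) (Or.inl hrt), one_mul]; exact hr'
  have hq' : r' / r ≠ ∞ := ENNReal.div_ne_top (hr1'.trans ENNReal.one_lt_top).ne hr0
  obtain ⟨w', C, hC, h1, h2, h3, h4⟩ := exists_almost_invariant_weight hw hgrs hq hq' F
  set t := ∑' x : {x // x ∉ F}, H x * w x with ht
  refine ⟨w', C, r' + t, hC, ?_, h1, h2, fun g => ?_⟩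
  · calc r' + t < r' + (1 - r') :=
          ENNReal.add_lt_add_left (hr1'.trans ENNReal.one_lt_top).ne hF
      _ = 1 := add_tsub_cancel_of_le hr1'.le
  have hshift : ∀ y, ∑' x, H (x - y) * w' x ≤ (r' + t) * w' y := fun y => by
    rw [← (Equiv.addRight y).tsum_eq (fun x => H (x - y) * w' x)]
    simp only [Equiv.coe_addRight, add_sub_cancel_right]
    rw [← ENNReal.summable.tsum_add_tsum_compl (s := (F : Set G)) ENNReal.summable, add_mul]
    gcongr
    · calc ∑' x : (F : Set G), H x * w' (x + y) ≤ ∑' x : (F : Set G), H x * (r' / r * w' y) := by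
            gcongr with x
            rw [add_comm]
            exact h4 x x.2 y
        _ ≤ (∑' x, H x) * (r' / r * w' y) := by
            rw [ENNReal.tsum_mul_right]
            gcongr
            exact ENNReal.tsum_comp_le_tsum_of_injective Subtype.val_injective _
        _ ≤ r * (r' / r * w' y) := by gcongr
        _ = r' * w' y := by rw [← mul_assoc, ENNReal.mul_div_cancel hr0 hrt]
    · calc ∑' x : ((F : Set G)ᶜ : Set G), H x * w' (x + y)
          ≤ ∑' x : ((F : Set G)ᶜ : Set G), H x * w x * w' y := by
            refine ENNReal.tsum_le_tsum fun x => ?_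
            rw [mul_assoc, add_comm, mul_comm (w _)]
            gcongr
            exact h3 _ _
        _ = t * w' y := by rw [ENNReal.tsum_mul_right]; rfl
  calc ∑' x, (∑' y, H (x - y) * g y) * w' x = ∑' y, g y * ∑' x, H (x - y) * w' x := by
        simp_rw [← ENNReal.tsum_mul_right, ← ENNReal.tsum_mul_left]
        rw [ENNReal.tsum_comm]
        exact tsum_congr fun y => tsum_congr fun x => by ring
    _ ≤ ∑' y, g y * ((r' + t) * w' y) := by gcongr with y; exact hshift y
    _ = _ := by rw [← ENNReal.tsum_mul_left]; exact tsum_congr fun y => by ring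

/-- A bounded solution of `α ≤ c + H * α`, with `H` of `ℓ¹` norm less than one, inherits weighted
summability from `c` and `H`, for every weight of subexponential growth. -/
theorem tsum_mul_weight_ne_top {w : G → ℝ≥0∞}
    (hw : ∀ x y, w (x + y) ≤ w x * w y)
    (hgrs : ∀ s : G, ∀ q : ℝ≥0∞, 1 < q → q ≠ ∞ →
      ∃ C : ℝ≥0∞, C ≠ ∞ ∧ ∀ m : ℕ, w (m • s) ≤ C * q ^ m)
    {H c α : G → ℝ≥0∞} (hH : ∑' x, H x < 1) (hHw : ∑' x, H x * w x ≠ ∞)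
    (hc : ∑' x, c x * w x ≠ ∞) {K : ℝ≥0∞} (hK : K ≠ ∞) (hα : ∀ x, α x ≤ K)
    (h : ∀ x, α x ≤ c x + ∑' y, H (x - y) * α y) :
    ∑' x, α x * w x ≠ ∞ := by
  obtain ⟨w', C, Q, hC, hQ, h1, h2, h3⟩ := exists_contracting_weight hw hgrs hH hHw
  set T : (G → ℝ≥0∞) → G → ℝ≥0∞ := fun g x => ∑' y, H (x - y) * g y with hT
  set h' := ∑' x, H x with hh'
  have hsup : ∀ m x, T^[m] α x ≤ h' ^ m * K := by
    intro m
    induction m with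
    | zero => simpa using hα
    | succ m ih =>
      intro x
      rw [Function.iterate_succ_apply']
      calc T (T^[m] α) x ≤ ∑' y, H (x - y) * (h' ^ m * K) := by
            simp only [hT]; gcongr with y; exact ih y
        _ = h' ^ (m + 1) * K := by
            rw [ENNReal.tsum_mul_right, hh', ← (Equiv.subLeft x).tsum_eq H, pow_succ', mul_assoc]
            rfl
  have hiter : ∀ M x, α x ≤ ∑ m ∈ Finset.range M, T^[m] c x + T^[M] α x := by
    intro M
    induction M with
    | zero => simp
    | succ M ih =>
      intro x
      refine (h x).trans ?_
      rw [Finset.sum_range_succ', add_right_comm, add_comm, Function.iterate_zero_apply]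
      gcongr
      calc ∑' y, H (x - y) * α y
          ≤ ∑' y, H (x - y) * (∑ m ∈ Finset.range M, T^[m] c y + T^[M] α y) := by
            gcongr with y; exact ih y
        _ = _ := by
            simp_rw [mul_add, Finset.mul_sum, ENNReal.tsum_add]
            rw [Summable.tsum_finsetSum fun _ _ => ENNReal.summable]
            simp_rw [Function.iterate_succ_apply']
            rfl
  have hle : ∀ x, α x ≤ ∑' m, T^[m] c x := by
    intro x
    have hlim : Tendsto (fun M : ℕ => ∑' m, T^[m] c x + h' ^ M * K) atTop
        (nhds (∑' m, T^[m] c x + 0 * K)) :=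
      tendsto_const_nhds.add
        (ENNReal.Tendsto.mul_const (ENNReal.tendsto_pow_atTop_nhds_zero_of_lt_one hH) (Or.inr hK))
    rw [zero_mul, add_zero] at hlim
    refine ge_of_tendsto' hlim fun M => (hiter M x).trans ?_
    exact add_le_add (ENNReal.sum_le_tsum _) (hsup M x)
  have hnorm : ∀ m, ∑' x, T^[m] c x * w' x ≤ Q ^ m * ∑' x, c x * w' x := by
    intro m
    induction m with
    | zero => simp
    | succ m ih =>
      rw [Function.iterate_succ_apply', pow_succ', mul_assoc]
      exact (h3 _).trans (by gcongr)
  have hfin : (∑' m, Q ^ m) * (C * ∑' x, c x * w x) ≠ ∞ := by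
    rw [ENNReal.tsum_geometric]
    exact ENNReal.mul_ne_top (ENNReal.inv_ne_top.2 (tsub_pos_of_lt hQ).ne')
      (ENNReal.mul_ne_top hC hc)
  refine ne_top_of_le_ne_top hfin ?_
  calc ∑' x, α x * w x ≤ ∑' x, (∑' m, T^[m] c x) * w' x := by
        gcongr with x
        · exact hle x
        · exact h1 x
    _ = ∑' m, ∑' x, T^[m] c x * w' x := by
        simp_rw [← ENNReal.tsum_mul_right]; exact ENNReal.tsum_comm
    _ ≤ ∑' m, Q ^ m * ∑' x, c x * w' x := by gcongr with m; exact hnorm m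
    _ = (∑' m, Q ^ m) * ∑' x, c x * w' x := ENNReal.tsum_mul_right
    _ ≤ (∑' m, Q ^ m) * (C * ∑' x, c x * w x) := by
        gcongr
        rw [← ENNReal.tsum_mul_left]
        refine ENNReal.tsum_le_tsum fun x => ?_
        calc c x * w' x ≤ c x * (C * w x) := by gcongr; exact h2 x
          _ = _ := by ring

end Renorming

section IntegerVectors

variable {I : Type*} [Fintype I]

/-- The mass of a weight on the ball of radius `R` around the origin in `ℤᴵ`. -/
def ballMass (w : (I → ℤ) → ℝ≥0∞) (R : ℝ) : ℝ≥0∞ := ∑' r : I → ℤ, if ‖r‖ ≤ R then w r else 0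

theorem ballMass_ne_top {w : (I → ℤ) → ℝ≥0∞} (hw : ∀ x, w x ≠ ∞) (R : ℝ) :
    ballMass w R ≠ ∞ := by
  have hfin : {r : I → ℤ | ‖r‖ ≤ R}.Finite := by
    have := (isCompact_closedBall (0 : I → ℤ) R).finite ⟨inferInstance⟩
    simpa [Metric.closedBall] using this
  rw [ballMass, tsum_eq_sum (s := hfin.toFinset) (fun r hr => by simp_all)]
  refine ENNReal.sum_ne_top.2 fun r _ => ?_
  split_ifs
  · exact hw r
  · exact ENNReal.zero_ne_top

theorem le_ballMass (w : (I → ℤ) → ℝ≥0∞) {R : ℝ} {r : I → ℤ} (hr : ‖r‖ ≤ R) :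
    w r ≤ ballMass w R :=
  (by simp [hr] : w r ≤ if ‖r‖ ≤ R then w r else 0).trans
    (ENNReal.le_tsum (f := fun r => if ‖r‖ ≤ R then w r else 0) r)

theorem tsum_shifted_ball (R : ℝ) (x : I → ℤ) :
    (∑' y : I → ℤ, if ‖y - x‖ ≤ R then (1 : ℝ≥0∞) else 0) = ballMass (I := I) 1 R := by
  rw [ballMass, ← (Equiv.addRight x).tsum_eq]
  simp

/-- Spreading out a weighted summable family over balls of fixed radius keeps it weighted
summable. -/
theorem tsum_spread_ne_top {κ : Type*} {w : (I → ℤ) → ℝ≥0∞} (hwt : ∀ x, w x ≠ ∞)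
    (hw : ∀ x y, w (x + y) ≤ w x * w y) {f : κ → ℝ≥0∞} {φ : κ → I → ℤ}
    (hf : ∑' i, f i * w (φ i) ≠ ∞) (R : ℝ) :
    ∑' x, (∑' i, if ‖x - φ i‖ ≤ R then f i else 0) * w x ≠ ∞ := by
  refine ne_top_of_le_ne_top (ENNReal.mul_ne_top hf (ballMass_ne_top hwt R)) ?_
  simp_rw [← ENNReal.tsum_mul_right]
  rw [ENNReal.tsum_comm]
  refine ENNReal.tsum_le_tsum fun i => ?_
  rw [← (Equiv.addRight (φ i)).tsum_eq, ballMass, ← ENNReal.tsum_mul_left]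
  refine ENNReal.tsum_le_tsum fun r => ?_
  simp only [Equiv.coe_addRight, add_sub_cancel_right]
  split_ifs
  · rw [mul_assoc, add_comm]
    gcongr
    exact hw _ _
  · simp

/-- Coordinatewise integer division. -/
def floorDiv (L : ℕ) (x : I → ℤ) : I → ℤ := fun i => x i / L

theorem norm_nsmul_int (L : ℕ) (x : I → ℤ) : ‖L • x‖ = L * ‖x‖ := by
  rw [← natCast_zsmul, norm_smul]
  simp

theorem norm_sub_floorDiv_le {L : ℕ} (hL : 0 < L) (x : I → ℤ) :
    ‖x - L • floorDiv L x‖ ≤ L := by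
  refine (pi_norm_le_iff_of_nonneg (Nat.cast_nonneg L)).2 fun i => ?_
  have hL' : (0 : ℤ) < L := by exact_mod_cast hL
  have h : (x - L • floorDiv L x) i = x i % L := by
    simp [floorDiv, Int.emod_def]
  rw [h, Int.norm_eq_abs, abs_of_nonneg (by exact_mod_cast Int.emod_nonneg _ hL'.ne')]
  exact_mod_cast (Int.emod_lt_of_pos _ hL').le

/-- A trapezoidal cutoff function at scale `L`. -/
def cutoff (L : ℕ) (x : I → ℤ) : ℝ := max 0 (min 1 (2 - ‖x‖ / L))

theorem cutoff_nonneg (L : ℕ) (x : I → ℤ) : 0 ≤ cutoff L x := le_max_left _ _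

theorem cutoff_le_one (L : ℕ) (x : I → ℤ) : cutoff L x ≤ 1 :=
  max_le zero_le_one (min_le_left _ _)

theorem cutoff_eq_one {L : ℕ} {x : I → ℤ} (hx : ‖x‖ ≤ L) : cutoff L x = 1 := by
  have h : ‖x‖ / L ≤ 1 := div_le_one_of_le₀ hx (Nat.cast_nonneg L)
  rw [cutoff, min_eq_left (by linarith), max_eq_right zero_le_one]

theorem cutoff_eq_zero {L : ℕ} (hL : 0 < L) {x : I → ℤ} (hx : 2 * L ≤ ‖x‖) :
    cutoff L x = 0 := by
  have h : 2 ≤ ‖x‖ / L := (le_div_iff₀ (by exact_mod_cast hL)).2 hx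
  exact max_eq_left ((min_le_right _ _).trans (by linarith))

theorem abs_cutoff_sub_le (L : ℕ) (x y : I → ℤ) :
    |cutoff L x - cutoff L y| ≤ min 1 (‖x - y‖ / L) := by
  refine le_min ?_ ?_
  · have := cutoff_nonneg L x
    have := cutoff_nonneg L y
    have := cutoff_le_one L x
    have := cutoff_le_one L y
    rw [abs_le]
    constructor <;> linarith
  · calc |cutoff L x - cutoff L y| ≤ |min 1 (2 - ‖x‖ / L) - min 1 (2 - ‖y‖ / L)| := by
          simpa [cutoff, max_comm] using
            abs_max_sub_max_le_abs (min 1 (2 - ‖x‖ / L)) (min 1 (2 - ‖y‖ / L)) 0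
      _ ≤ |(2 - ‖x‖ / L) - (2 - ‖y‖ / L)| := by
          have := abs_min_sub_min_le_max 1 (2 - ‖x‖ / L) 1 (2 - ‖y‖ / L)
          simpa using this
      _ = |‖x‖ - ‖y‖| / L := by
          rw [← abs_neg, ← Nat.abs_cast L, ← abs_div]; simp only [Nat.abs_cast]; congr 1; ring
      _ ≤ ‖x - y‖ / L := by gcongr; exact abs_norm_sub_norm_le x y

/-- The commutator kernel: it dominates the commutators of a matrix with envelope `θ` with cutoffs
whose centres differ by `L • i`. -/
def commKernel (L : ℕ) (θ : (I → ℤ) → ℝ≥0∞) (i z : I → ℤ) : ℝ≥0∞ :=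
  if ‖z - L • i‖ ≤ 3 * L ∨ ‖i‖ ≤ 3 then θ z * ENNReal.ofReal (min 1 (‖z‖ / L)) else 0

theorem mul_cutoff_sub_le_commKernel {L : ℕ} (hL : 0 < L) (θ : (I → ℤ) → ℝ≥0∞)
    (x y j : I → ℤ) :
    θ (x - y) * ENNReal.ofReal |cutoff L (y - L • j) - cutoff L (x - L • j)| ≤
      commKernel L θ (j - floorDiv L y) (x - y) := by
  have hLr : (0 : ℝ) < L := by exact_mod_cast hL
  rw [commKernel]
  split_ifs with h
  · gcongr
    rw [abs_sub_comm]
    simpa using abs_cutoff_sub_le L (x - L • j) (y - L • j)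
  · push Not at h
    obtain ⟨h1, h2⟩ := h
    have hy := norm_sub_floorDiv_le hL y
    set k := floorDiv L y
    have hy0 : cutoff L (y - L • j) = 0 := by
      refine cutoff_eq_zero hL ?_
      have h3 : ‖L • (j - k)‖ ≤ ‖y - L • j‖ + ‖y - L • k‖ := by
        rw [add_comm]
        refine le_trans (le_of_eq ?_) (norm_sub_le (y - L • k) (y - L • j))
        congr 1
        rw [smul_sub]; abel
      rw [norm_nsmul_int] at h3
      nlinarith
    have hx0 : cutoff L (x - L • j) = 0 := by
      refine cutoff_eq_zero hL ?_
      have h3 : ‖x - y - L • (j - k)‖ ≤ ‖x - L • j‖ + ‖y - L • k‖ := by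
        refine le_trans (le_of_eq ?_) (norm_sub_le (x - L • j) (y - L • k))
        congr 1
        rw [smul_sub]; abel
      linarith
    rw [hy0, hx0]
    simp

theorem tsum_near_le {L : ℕ} (hL : 0 < L) (z : I → ℤ) :
    (∑' i : I → ℤ, if ‖z - L • i‖ ≤ 3 * L ∨ ‖i‖ ≤ 3 then (1 : ℝ≥0∞) else 0) ≤
      2 * ballMass (I := I) 1 4 := by
  have hLr : (0 : ℝ) < L := by exact_mod_cast hL
  calc _ ≤ ∑' i : I → ℤ, ((if ‖i - floorDiv L z‖ ≤ 4 then (1 : ℝ≥0∞) else 0) +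
          if ‖i‖ ≤ 4 then (1 : (I → ℤ) → ℝ≥0∞) i else 0) := by
        refine ENNReal.tsum_le_tsum fun i => ?_
        by_cases h2 : ‖i‖ ≤ 4
        · split_ifs <;> simp
        by_cases h1 : ‖z - L • i‖ ≤ 3 * L
        · have h3 : ‖L • (i - floorDiv L z)‖ ≤ ‖z - L • floorDiv L z‖ + ‖z - L • i‖ := by
            refine le_trans (le_of_eq ?_) (norm_sub_le (z - L • floorDiv L z) (z - L • i))
            congr 1
            rw [smul_sub]; abel
          rw [norm_nsmul_int] at h3
          have h4 := norm_sub_floorDiv_le hL z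
          have h5 : ‖i - floorDiv L z‖ ≤ 4 := by nlinarith
          rw [if_pos h5]
          split_ifs <;> simp
        · have h3 : ¬ ‖i‖ ≤ 3 := by linarith
          rw [if_neg (not_or.2 ⟨h1, h3⟩)]
          exact zero_le
    _ = _ := by
        rw [ENNReal.tsum_add, tsum_shifted_ball, ← ballMass, two_mul]

theorem tsum_tsum_commKernel_le {L : ℕ} (hL : 0 < L) (θ : (I → ℤ) → ℝ≥0∞) :
    ∑' i, ∑' z, commKernel L θ i z ≤
      2 * ballMass (I := I) 1 4 * ∑' z, θ z * ENNReal.ofReal (min 1 (‖z‖ / L)) := by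
  rw [ENNReal.tsum_comm, ← ENNReal.tsum_mul_left]
  refine ENNReal.tsum_le_tsum fun z => ?_
  refine le_trans (le_of_eq ?_) (mul_le_mul_left (tsum_near_le hL z) _)
  rw [← ENNReal.tsum_mul_right]
  refine tsum_congr fun i => ?_
  simp [commKernel]

theorem tsum_commKernel_mul_weight_ne_top {L : ℕ} (hL : 0 < L) {w θ : (I → ℤ) → ℝ≥0∞}
    (hwt : ∀ x, w x ≠ ∞) (hw1 : ∀ x, 1 ≤ w x) (hw : ∀ x y, w (x + y) ≤ w x * w y)
    (hθ : ∑' z, θ z * w z ≠ ∞) :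
    ∑' i, (∑' z, commKernel L θ i z) * w (L • i) ≠ ∞ := by
  have hM : ∀ i z : I → ℤ, ‖z - L • i‖ ≤ 3 * L ∨ ‖i‖ ≤ 3 →
      w (L • i) ≤ w z * ballMass w (3 * L) := by
    rintro i z (h | h)
    · have h' : ‖L • i - z‖ ≤ 3 * L := by rwa [norm_sub_rev]
      calc w (L • i) = w (z + (L • i - z)) := by rw [add_sub_cancel]
        _ ≤ _ := (hw _ _).trans (by gcongr; exact le_ballMass w h')
    · have h' : ‖L • i‖ ≤ 3 * L := by
        rw [norm_nsmul_int, mul_comm]; gcongr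
      calc w (L • i) ≤ 1 * ballMass w (3 * L) := by rw [one_mul]; exact le_ballMass w h'
        _ ≤ _ := by gcongr; exact hw1 z
  have hfin : 2 * ballMass (I := I) 1 4 * ((∑' z, θ z * w z) * ballMass w (3 * L)) ≠ ∞ :=
    ENNReal.mul_ne_top (ENNReal.mul_ne_top (by simp) (ballMass_ne_top (by simp) _))
      (ENNReal.mul_ne_top hθ (ballMass_ne_top hwt _))
  refine ne_top_of_le_ne_top hfin ?_
  simp_rw [← ENNReal.tsum_mul_right]
  rw [ENNReal.tsum_comm, ← ENNReal.tsum_mul_left]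
  refine ENNReal.tsum_le_tsum fun z => ?_
  refine le_trans ?_ (mul_le_mul_left (tsum_near_le hL z) _)
  rw [← ENNReal.tsum_mul_right]
  refine ENNReal.tsum_le_tsum fun i => ?_
  rw [commKernel]
  split_ifs with h
  · rw [one_mul, mul_assoc, mul_assoc]
    refine mul_le_mul_right ?_ _
    calc _ ≤ 1 * (w z * ballMass w (3 * L)) := by
          gcongr
          · exact ENNReal.ofReal_le_one.2 (min_le_left _ _)
          · exact hM i z h
      _ = _ := one_mul _
  · simp

theorem exists_scale {θ : (I → ℤ) → ℝ≥0∞} (hθ : ∑' z, θ z ≠ ∞) {ε : ℝ≥0∞} (hε : 0 < ε) :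
    ∃ L : ℕ, 0 < L ∧ ∑' z, θ z * ENNReal.ofReal (min 1 (‖z‖ / L)) < ε := by
  let _ : MeasurableSpace (I → ℤ) := ⊤
  have h := tendsto_lintegral_of_dominated_convergence (μ := Measure.count)
    (F := fun (L : ℕ) z => θ z * ENNReal.ofReal (min 1 (‖z‖ / L))) (f := fun _ => 0) θ
    (fun _ => measurable_from_top)
    (fun L => Eventually.of_forall fun z =>
      mul_le_of_le_one_right' (ENNReal.ofReal_le_one.2 (min_le_left _ _)))
    (by rwa [lintegral_count])
    (Eventually.of_forall fun z => by
      have h1 : Tendsto (fun L : ℕ => min 1 (‖z‖ / L)) atTop (nhds 0) := by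
        have := (tendsto_const_nhds (x := (1 : ℝ))).min
          (tendsto_const_nhds.div_atTop tendsto_natCast_atTop_atTop :
            Tendsto (fun L : ℕ => ‖z‖ / (L : ℝ)) atTop (nhds 0))
        simpa using this
      have h2 := ENNReal.Tendsto.const_mul (a := θ z) (ENNReal.tendsto_ofReal h1)
        (Or.inr (ne_top_of_le_ne_top hθ (ENNReal.le_tsum z)))
      simpa using h2)
  simp only [lintegral_count, tsum_zero] at h
  obtain ⟨L, hL, hL'⟩ := ((h.eventually (gt_mem_nhds hε)).and (eventually_gt_atTop 0)).exists
  exact ⟨L, hL', hL⟩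

end IntegerVectors

section Matrices

variable {ι : Type*}

theorem lp_enorm_eq_ellTwo (u : lp (fun _ : ι => ℂ) 2) : ‖u‖ₑ = ellTwo fun l => ‖u l‖ₑ := by
  refine (ENNReal.pow_right_strictMono two_ne_zero).injective ?_
  have h : HasSum (fun l => ‖u l‖ ^ 2) (‖u‖ ^ 2) := by
    simpa using lp.hasSum_norm (p := 2) (by simp) u
  simp only [ellTwo_sq, ← ofReal_norm, ← ENNReal.ofReal_pow (norm_nonneg _)]
  rw [← h.tsum_eq, ENNReal.ofReal_tsum_of_nonneg (fun _ => by positivity) h.summable]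

/-- Multiplication of an `ℓ²` sequence by a bounded real sequence. -/
def lpMul (χ : ι → ℝ) (hχ : ∀ l, |χ l| ≤ 1) (u : lp (fun _ : ι => ℂ) 2) :
    lp (fun _ : ι => ℂ) 2 :=
  ⟨fun l => χ l * u l, (lp.memℓp u).mono' fun l => by
    rw [norm_mul, Complex.norm_real]
    exact mul_le_of_le_one_left (norm_nonneg _) (hχ l)⟩

theorem lpMul_apply (χ : ι → ℝ) (hχ : ∀ l, |χ l| ≤ 1) (u : lp (fun _ : ι => ℂ) 2) (l : ι) :
    lpMul χ hχ u l = χ l * u l := rfl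

theorem tsum_comp_le_of_fiber {G : Type*} {p : ι → G} {N : ℝ≥0∞}
    (hp : ∀ x, ∑' l, (p ⁻¹' {x}).indicator (1 : ι → ℝ≥0∞) l ≤ N) (F : G → ℝ≥0∞) :
    ∑' l, F (p l) ≤ N * ∑' x, F x := by
  classical
  calc ∑' l, F (p l) = ∑' l, ∑' x, (p ⁻¹' {x}).indicator (1 : ι → ℝ≥0∞) l * F x := by
        refine tsum_congr fun l => ?_
        rw [tsum_eq_single (p l) fun x hx => by simp [hx.symm]]
        simp
    _ = ∑' x, (∑' l, (p ⁻¹' {x}).indicator (1 : ι → ℝ≥0∞) l) * F x := by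
        rw [ENNReal.tsum_comm]; simp_rw [ENNReal.tsum_mul_right]
    _ ≤ ∑' x, N * F x := by gcongr with x; exact hp x
    _ = _ := ENNReal.tsum_mul_left

theorem tsum_option_eq_add {κ : Type*} (f : Option κ → ℝ≥0∞) :
    ∑' o, f o = f none + ∑' k, f (some k) := by
  rw [← (Equiv.optionEquivSumPUnit.{0} κ).symm.tsum_eq,
    ENNReal.summable.tsum_sum ENNReal.summable, add_comm]
  simp

variable {I : Type*} [Fintype I]

/-- The `ℓ²` norm localized around the point `L • j`. -/
def locNorm (L : ℕ) (p : ι → I → ℤ) (j : I → ℤ) (f : ι → ℝ≥0∞) : ℝ≥0∞ :=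
  ellTwo fun l => ENNReal.ofReal (cutoff L (p l - L • j)) * f l

theorem abs_cutoff_le_one (L : ℕ) (x : I → ℤ) : |cutoff L x| ≤ 1 := by
  rw [abs_of_nonneg (cutoff_nonneg L x)]; exact cutoff_le_one L x

theorem enorm_cutoff (L : ℕ) (x : I → ℤ) :
    ‖(cutoff L x : ℂ)‖ₑ = ENNReal.ofReal (cutoff L x) := by
  rw [← ofReal_norm, Complex.norm_real, Real.norm_of_nonneg (cutoff_nonneg L x)]

theorem locNorm_le_ellTwo (L : ℕ) (p : ι → I → ℤ) (j : I → ℤ) (f : ι → ℝ≥0∞) :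
    locNorm L p j f ≤ ellTwo f :=
  ellTwo_mono fun _ => mul_le_of_le_one_left' (ENNReal.ofReal_le_one.2 (cutoff_le_one L _))

theorem le_locNorm_floorDiv {L : ℕ} (hL : 0 < L) (p : ι → I → ℤ) (f : ι → ℝ≥0∞) (l : ι) :
    f l ≤ locNorm L p (floorDiv L (p l)) f := by
  refine le_trans (le_of_eq ?_) (le_ellTwo _ l)
  rw [cutoff_eq_one (norm_sub_floorDiv_le hL _)]
  simp

/-- The localized norms of a vector dominate the commutator of a convolution-dominated matrix
with a cutoff. -/
theorem enorm_commutator_le {L : ℕ} (hL : 0 < L) {p : ι → I → ℤ} {N : ℝ≥0∞} (hN : N ≠ ∞)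
    (hp : ∀ x, ∑' l, (p ⁻¹' {x}).indicator (1 : ι → ℝ≥0∞) l ≤ N)
    {θ : (I → ℤ) → ℝ≥0∞} (hθ : ∑' z, θ z ≠ ∞)
    {A : ι → ι → ℂ} (hA : ∀ l m, ‖A l m‖ₑ ≤ θ (p l - p m))
    (u : lp (fun _ : ι => ℂ) 2) (j : I → ℤ) (l : ι) :
    ‖∑' m, A l m * (cutoff L (p m - L • j) * u m)‖ₑ ≤
      ENNReal.ofReal (cutoff L (p l - L • j)) * ‖∑' m, A l m * u m‖ₑ +
      ∑' k, ∑' m, commKernel L θ (j - k) (p l - p m) *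
        (ENNReal.ofReal (cutoff L (p m - L • k)) * ‖u m‖ₑ) := by
  classical
  have hsum : ∀ χ : ι → ℝ, (∀ m, |χ m| ≤ 1) → Summable fun m => A l m * (χ m * u m) := by
    intro χ hχ
    refine Summable.of_nnnorm (tsum_enorm_ne_top_iff_summable_nnnorm.1 ?_)
    refine ne_top_of_le_ne_top
      (ENNReal.mul_ne_top (ENNReal.mul_ne_top hN hθ) (enorm_ne_top (x := u))) ?_
    calc ∑' m, ‖A l m * (χ m * u m)‖ₑ ≤ ∑' m, θ (p l - p m) * ‖u‖ₑ := by
          refine ENNReal.tsum_le_tsum fun m => ?_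
          rw [enorm_mul]
          gcongr
          · exact hA l m
          · rw [← ofReal_norm, ← ofReal_norm, norm_mul, Complex.norm_real]
            exact ENNReal.ofReal_le_ofReal ((mul_le_of_le_one_left (norm_nonneg _) (hχ m)).trans
              (lp.norm_apply_le_norm two_ne_zero u m))
      _ ≤ N * (∑' z, θ (p l - z)) * ‖u‖ₑ := by
          rw [ENNReal.tsum_mul_right]
          gcongr
          exact tsum_comp_le_of_fiber hp fun z => θ (p l - z)
      _ = _ := by rw [← (Equiv.subLeft (p l)).tsum_eq θ]; rfl
  set χ : ι → ℝ := fun m => cutoff L (p m - L • j) with hχ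
  have h1 := hsum χ fun m => abs_cutoff_le_one L _
  have h2 := hsum (fun _ => 1) (by simp)
  simp only [Complex.ofReal_one, one_mul] at h2
  have hsplit : ∑' m, A l m * (χ m * u m) =
      χ l * ∑' m, A l m * u m + ∑' m, A l m * (((χ m - χ l : ℝ) : ℂ) * u m) := by
    rw [← tsum_mul_left, ← (h2.mul_left _).tsum_add]
    · refine tsum_congr fun m => ?_
      push_cast
      ring
    · refine (h1.sub (h2.mul_left (χ l : ℂ))).congr fun m => ?_
      push_cast
      ring
  rw [hsplit]
  refine (enorm_add_le _ _).trans (add_le_add ?_ ?_)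
  · rw [enorm_mul, hχ, enorm_cutoff]
  rw [ENNReal.tsum_comm]
  refine enorm_tsum_le_tsum_enorm.trans (ENNReal.tsum_le_tsum fun m => ?_)
  refine le_trans ?_ (ENNReal.le_tsum (floorDiv L (p m)))
  rw [cutoff_eq_one (norm_sub_floorDiv_le hL _), ENNReal.ofReal_one, one_mul, enorm_mul, enorm_mul,
    ← mul_assoc]
  refine mul_le_mul_left ?_ _
  refine le_trans ?_ (mul_cutoff_sub_le_commKernel hL θ (p l) (p m) j)
  rw [← ofReal_norm (((χ m - χ l : ℝ) : ℂ)), Complex.norm_real, Real.norm_eq_abs]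
  gcongr
  exact hA l m

theorem locNorm_le {L : ℕ} (hL : 0 < L) {p : ι → I → ℤ} {N : ℝ≥0∞} (hN : N ≠ ∞)
    (hp : ∀ x, ∑' l, (p ⁻¹' {x}).indicator (1 : ι → ℝ≥0∞) l ≤ N)
    {θ : (I → ℤ) → ℝ≥0∞} (hθ : ∑' z, θ z ≠ ∞)
    {A : ι → ι → ℂ} (hA : ∀ l m, ‖A l m‖ₑ ≤ θ (p l - p m))
    {T S : lp (fun _ : ι => ℂ) 2 →L[ℂ] lp (fun _ : ι => ℂ) 2}
    (hT : ∀ c l, T c l = ∑' m, A l m * c m) (hST : ∀ c, S (T c) = c)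
    (u : lp (fun _ : ι => ℂ) 2) (j : I → ℤ) :
    locNorm L p j (fun l => ‖u l‖ₑ) ≤ ‖S‖ₑ * locNorm L p j (fun l => ‖T u l‖ₑ) +
      ∑' k, ‖S‖ₑ * N * (∑' z, commKernel L θ (j - k) z) * locNorm L p k (fun l => ‖u l‖ₑ) := by
  set χu := lpMul (fun l => cutoff L (p l - L • j)) (fun l => abs_cutoff_le_one L _) u with hχu
  have hloc : locNorm L p j (fun l => ‖u l‖ₑ) = ‖χu‖ₑ := by
    rw [lp_enorm_eq_ellTwo, locNorm]
    simp only [hχu, lpMul_apply, enorm_mul, enorm_cutoff]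
  have hS : ‖χu‖ₑ ≤ ‖S‖ₑ * ‖T χu‖ₑ := by
    conv_lhs => rw [← hST χu]
    exact S.le_opENorm _
  have hker : ∀ k, ellTwo (fun l => ∑' m, commKernel L θ (j - k) (p l - p m) *
      (ENNReal.ofReal (cutoff L (p m - L • k)) * ‖u m‖ₑ)) ≤
      N * (∑' z, commKernel L θ (j - k) z) * locNorm L p k (fun l => ‖u l‖ₑ) := by
    intro k
    refine ellTwo_schur (fun l => ?_) (fun m => ?_) _
    · refine (tsum_comp_le_of_fiber hp fun z => commKernel L θ (j - k) (p l - z)).trans_eq ?_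
      rw [← (Equiv.subLeft (p l)).tsum_eq (commKernel L θ (j - k))]; rfl
    · refine (tsum_comp_le_of_fiber hp fun z => commKernel L θ (j - k) (z - p m)).trans_eq ?_
      rw [← (Equiv.subRight (p m)).tsum_eq (commKernel L θ (j - k))]; rfl
  have hmain : ellTwo (fun l => ‖T χu l‖ₑ) ≤ locNorm L p j (fun l => ‖T u l‖ₑ) +
      ∑' k, N * (∑' z, commKernel L θ (j - k) z) * locNorm L p k (fun l => ‖u l‖ₑ) := by
    have h := ellTwo_le_tsum (f := fun l => ‖T χu l‖ₑ)
      (F := fun o : Option (I → ℤ) => o.elim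
        (fun l => ENNReal.ofReal (cutoff L (p l - L • j)) * ‖T u l‖ₑ)
        (fun k l => ∑' m, commKernel L θ (j - k) (p l - p m) *
          (ENNReal.ofReal (cutoff L (p m - L • k)) * ‖u m‖ₑ)))
      (by rw [← lp_enorm_eq_ellTwo]; exact enorm_ne_top)
      (fun l => by
        rw [tsum_option_eq_add]
        simp only [Option.elim]
        rw [hT, hT]
        exact enorm_commutator_le hL hN hp hθ hA u j l)
    rw [tsum_option_eq_add] at h
    exact h.trans (add_le_add le_rfl (ENNReal.tsum_le_tsum hker))
  rw [hloc]
  refine hS.trans ?_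
  rw [lp_enorm_eq_ellTwo (T χu)]
  refine (mul_le_mul_right hmain _).trans_eq ?_
  rw [mul_add, ← ENNReal.tsum_mul_left]
  simp only [mul_assoc]

/-- Sjöstrand's form of Wiener's lemma, with weights: the columns of a left and right inverse of a
convolution-dominated matrix are uniformly dominated by a summable envelope. -/
theorem exists_inverse_envelope [DecidableEq ι] {p : ι → I → ℤ} {N : ℝ≥0∞} (hN : N ≠ ∞)
    (hp : ∀ x, ∑' l, (p ⁻¹' {x}).indicator (1 : ι → ℝ≥0∞) l ≤ N)
    {w θ : (I → ℤ) → ℝ≥0∞} (hwt : ∀ x, w x ≠ ∞) (hw1 : ∀ x, 1 ≤ w x)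
    (hw : ∀ x y, w (x + y) ≤ w x * w y)
    (hgrs : ∀ s : I → ℤ, ∀ q : ℝ≥0∞, 1 < q → q ≠ ∞ →
      ∃ C : ℝ≥0∞, C ≠ ∞ ∧ ∀ m : ℕ, w (m • s) ≤ C * q ^ m)
    (hθ : ∑' z, θ z * w z ≠ ∞)
    {A : ι → ι → ℂ} (hA : ∀ l m, ‖A l m‖ₑ ≤ θ (p l - p m))
    {T S : lp (fun _ : ι => ℂ) 2 →L[ℂ] lp (fun _ : ι => ℂ) 2}
    (hT : ∀ c l, T c l = ∑' m, A l m * c m) (hST : ∀ c, S (T c) = c) (hTS : ∀ c, T (S c) = c) :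
    ∃ b : (I → ℤ) → ℝ≥0∞, ∑' x, b x * w x ≠ ∞ ∧
      ∀ l m, ‖S (lp.single 2 m (1 : ℂ)) l‖ₑ ≤ b (p l - p m) := by
  have hθ1 : ∑' z, θ z ≠ ∞ := by
    refine ne_top_of_le_ne_top hθ (ENNReal.tsum_le_tsum fun z => ?_)
    exact le_mul_of_one_le_right' (hw1 z)
  have hD : ‖S‖ₑ * N * (2 * ballMass (I := I) 1 4) ≠ ∞ :=
    ENNReal.mul_ne_top (ENNReal.mul_ne_top enorm_ne_top hN)
      (ENNReal.mul_ne_top (by simp) (ballMass_ne_top (by simp) _))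
  set D := ‖S‖ₑ * N * (2 * ballMass (I := I) 1 4) with hDdef
  obtain ⟨L, hL, hLθ⟩ := exists_scale hθ1 (ε := (D + 1)⁻¹)
    (ENNReal.inv_pos.2 (ENNReal.add_ne_top.2 ⟨hD, ENNReal.one_ne_top⟩))
  have hLr : (0 : ℝ) < L := by exact_mod_cast hL
  set H : (I → ℤ) → ℝ≥0∞ := fun i => ‖S‖ₑ * N * ∑' z, commKernel L θ i z with hH
  have hH1 : ∑' i, H i < 1 := by
    rw [hH, ENNReal.tsum_mul_left]
    calc _ ≤ ‖S‖ₑ * N * (2 * ballMass (I := I) 1 4 *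
            ∑' z, θ z * ENNReal.ofReal (min 1 (‖z‖ / L))) := by
          gcongr; exact tsum_tsum_commKernel_le hL θ
      _ = D * ∑' z, θ z * ENNReal.ofReal (min 1 (‖z‖ / L)) := by rw [hDdef]; ring
      _ ≤ D * (D + 1)⁻¹ := by gcongr
      _ < 1 := by
          rw [← div_eq_mul_inv]
          refine ENNReal.div_lt_of_lt_mul ?_
          rw [one_mul]
          exact ENNReal.lt_add_right hD one_ne_zero
  have hHw : ∑' i, H i * w (L • i) ≠ ∞ := by
    simp_rw [hH, mul_assoc]
    simp_rw [ENNReal.tsum_mul_left]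
    exact ENNReal.mul_ne_top enorm_ne_top (ENNReal.mul_ne_top hN
      (tsum_commKernel_mul_weight_ne_top hL hwt hw1 hw hθ))
  set e : ι → lp (fun _ : ι => ℂ) 2 := fun m => lp.single 2 m (1 : ℂ) with he
  have henorm : ∀ m, ‖e m‖ₑ = 1 := fun m => by
    rw [← ofReal_norm, he, lp.norm_single (by simp)]; simp
  set α : (I → ℤ) → ℝ≥0∞ :=
    fun i => ⨆ m, locNorm L p (i + floorDiv L (p m)) (fun l => ‖S (e m) l‖ₑ) with hα
  set c : (I → ℤ) → ℝ≥0∞ := fun i => if ‖i‖ ≤ 3 then ‖S‖ₑ else 0 with hc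
  have hαS : ∀ i, α i ≤ ‖S‖ₑ := fun i => by
    refine iSup_le fun m => (locNorm_le_ellTwo _ _ _ _).trans ?_
    rw [← lp_enorm_eq_ellTwo]
    exact (S.le_opENorm _).trans_eq (by rw [henorm, mul_one])
  have hcw : ∑' i, c i * w (L • i) ≠ ∞ := by
    refine ne_top_of_le_ne_top (ENNReal.mul_ne_top (enorm_ne_top (x := S))
      (ballMass_ne_top (w := fun i => w (L • i)) (fun i => hwt _) 3)) ?_
    rw [ballMass, ← ENNReal.tsum_mul_left]
    refine ENNReal.tsum_le_tsum fun i => ?_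
    simp only [hc]
    split_ifs <;> simp
  have hrec : ∀ i, α i ≤ c i + ∑' k, H (i - k) * α k := by
    intro i
    refine iSup_le fun m => ?_
    refine (locNorm_le hL hN hp hθ1 hA hT hST (S (e m)) _).trans (add_le_add ?_ ?_)
    · rw [hTS]
      simp only [hc]
      split_ifs with hi
      · refine mul_le_of_le_one_right' ((locNorm_le_ellTwo _ _ _ _).trans ?_)
        rw [← lp_enorm_eq_ellTwo, henorm]
      · have hzero : cutoff L (p m - L • (i + floorDiv L (p m))) = 0 := by
          refine cutoff_eq_zero hL ?_
          have h3 : ‖L • i‖ ≤ ‖p m - L • floorDiv L (p m)‖ +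
              ‖p m - L • (i + floorDiv L (p m))‖ := by
            refine le_trans (le_of_eq ?_) (norm_sub_le _ _)
            congr 1
            rw [smul_add]; abel
          rw [norm_nsmul_int] at h3
          have h4 := norm_sub_floorDiv_le hL (p m)
          nlinarith
        have : locNorm L p (i + floorDiv L (p m)) (fun l => ‖e m l‖ₑ) = 0 := by
          have hz : ∀ l, ENNReal.ofReal (cutoff L (p l - L • (i + floorDiv L (p m)))) *
              ‖e m l‖ₑ = 0 := by
            intro l
            by_cases hlm : l = m
            · rw [hlm, hzero]; simp
            · rw [he, lp.single_apply_ne _ _ _ hlm]; simp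
          simp only [locNorm, ellTwo, hz]
          simp
        rw [this, mul_zero]
    · rw [← (Equiv.addRight (floorDiv L (p m))).tsum_eq]
      refine ENNReal.tsum_le_tsum fun k => ?_
      simp only [Equiv.coe_addRight, add_sub_add_right_eq_sub]
      refine mul_le_mul_right ?_ _
      exact le_iSup (fun m => locNorm L p (k + floorDiv L (p m)) (fun l => ‖S (e m) l‖ₑ)) m
  have hαw := tsum_mul_weight_ne_top (w := fun i => w (L • i))
    (fun x y => by rw [smul_add]; exact hw _ _)
    (fun s q hq hq' => by
      obtain ⟨C, hC, hCs⟩ := hgrs (L • s) q hq hq'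
      exact ⟨C, hC, fun m => by rw [smul_comm]; exact hCs m⟩)
    hH1 hHw hcw enorm_ne_top hαS hrec
  refine ⟨fun x => ∑' i, if ‖x - L • i‖ ≤ 2 * L then α i else 0,
    tsum_spread_ne_top hwt hw (φ := fun i => L • i) hαw _, fun l m => ?_⟩
  set i := floorDiv L (p l) - floorDiv L (p m) with hi
  have hnear : ‖p l - p m - L • i‖ ≤ 2 * L := by
    have h1 := norm_sub_floorDiv_le hL (p l)
    have h2 := norm_sub_floorDiv_le hL (p m)
    have h3 := norm_sub_le (p l - L • floorDiv L (p l)) (p m - L • floorDiv L (p m))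
    have h4 : p l - p m - L • i =
        (p l - L • floorDiv L (p l)) - (p m - L • floorDiv L (p m)) := by
      rw [hi, smul_sub]; abel
    rw [h4]
    linarith
  refine le_trans ?_ (ENNReal.le_tsum i)
  rw [if_pos hnear]
  refine (le_locNorm_floorDiv hL p (fun l => ‖S (e m) l‖ₑ) l).trans ?_
  refine le_trans (le_of_eq ?_)
    (le_iSup (fun m => locNorm L p (i + floorDiv L (p m)) (fun l => ‖S (e m) l‖ₑ)) m)
  rw [hi, sub_add_cancel]

end Matrices

section Euclidean

variable {d : ℕ}

theorem isCompact_unitCube (d : ℕ) : IsCompact (unitCube d) := by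
  have h : unitCube d = WithLp.toLp 2 '' Set.univ.pi fun _ : Fin d ⊕ Fin d => Set.Icc (0 : ℝ) 1 := by
    ext z
    constructor
    · intro hz
      exact ⟨WithLp.ofLp z, fun i _ => hz i, rfl⟩
    · rintro ⟨y, hy, rfl⟩ i
      exact hy i trivial
  rw [h]
  exact (isCompact_univ_pi fun _ => isCompact_Icc).image (PiLp.continuous_toLp 2 _)

theorem intVec_add (k l : (Fin d ⊕ Fin d) → ℤ) : intVec (k + l) = intVec k + intVec l := by
  ext i; simp [intVec]

theorem intVec_nsmul (m : ℕ) (k : (Fin d ⊕ Fin d) → ℤ) :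
    intVec (m • k) = (m : ℝ) • intVec k := by
  ext i; simp [intVec]

/-- The coordinatewise integer part. -/
def floorVec (z : E2 d) : (Fin d ⊕ Fin d) → ℤ := fun i => ⌊z i⌋

theorem sub_floorVec_mem_unitCube (z : E2 d) : z - intVec (floorVec z) ∈ unitCube d := by
  intro i
  have h1 := Int.floor_le (z i)
  have h2 := Int.lt_floor_add_one (z i)
  simp only [intVec, floorVec, PiLp.sub_apply, Set.mem_Icc]
  constructor <;> linarith

theorem norm_floorVec_sub_le (x y : E2 d) :
    ‖floorVec x - floorVec y - floorVec (x - y)‖ ≤ 1 := by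
  rw [pi_norm_le_iff_of_nonneg zero_le_one]
  intro i
  have h : |⌊x i⌋ - ⌊y i⌋ - ⌊x i - y i⌋| ≤ 1 := by
    have h1 := Int.floor_le (x i)
    have h2 := Int.lt_floor_add_one (x i)
    have h3 := Int.floor_le (y i)
    have h4 := Int.lt_floor_add_one (y i)
    have h5 := Int.floor_le (x i - y i)
    have h6 := Int.lt_floor_add_one (x i - y i)
    rw [abs_le]
    constructor
    · have : (-2 : ℝ) < ((⌊x i⌋ - ⌊y i⌋ - ⌊x i - y i⌋ : ℤ) : ℝ) := by push_cast; linarith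
      have : (-2 : ℤ) < ⌊x i⌋ - ⌊y i⌋ - ⌊x i - y i⌋ := by exact_mod_cast this
      omega
    · have : ((⌊x i⌋ - ⌊y i⌋ - ⌊x i - y i⌋ : ℤ) : ℝ) < 2 := by push_cast; linarith
      have : ⌊x i⌋ - ⌊y i⌋ - ⌊x i - y i⌋ < 2 := by exact_mod_cast this
      omega
  rw [Int.norm_eq_abs]
  exact_mod_cast h

theorem le_cubeSup {Θ : E2 d → ℝ} (hΘ : Continuous Θ) (z : E2 d) :
    Θ z ≤ cubeSup Θ (floorVec z) := by
  refine (le_abs_self _).trans (le_csSup ?_ ⟨_, sub_floorVec_mem_unitCube z, by simp⟩)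
  exact ((isCompact_unitCube d).image (by fun_prop)).bddAbove

theorem cubeSup_nonneg (Θ : E2 d → ℝ) (k : (Fin d ⊕ Fin d) → ℤ) : 0 ≤ cubeSup Θ k :=
  Real.sSup_nonneg (by rintro _ ⟨z, _, rfl⟩; exact norm_nonneg _)

theorem fiber_floorVec_le {Λ : Set (E2 d)} (hΛ : RelativelySeparated Λ) :
    ∃ N : ℝ≥0∞, N ≠ ∞ ∧ ∀ x,
      ∑' l : Λ, ((fun l : Λ => floorVec (l : E2 d)) ⁻¹' {x}).indicator (1 : Λ → ℝ≥0∞) l ≤ N := by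
  classical
  obtain ⟨N, hN⟩ := hΛ
  obtain ⟨t, -, ht, hcover⟩ := (isCompact_unitCube d).finite_cover_balls zero_lt_one
  lift t to Finset (E2 d) using ht
  refine ⟨t.card * N, ENNReal.mul_ne_top (by simp) (by simp), fun x => ?_⟩
  have hball : ∀ c : E2 d, ∑' l : Λ, {l : Λ | dist (l : E2 d) (intVec x + c) ≤ 1}.indicator
      (1 : Λ → ℝ≥0∞) l ≤ N := by
    intro c
    have h := hN (intVec x + c)
    have himg : {l ∈ Λ | dist l (intVec x + c) ≤ 1} =
        Subtype.val '' {l : Λ | dist (l : E2 d) (intVec x + c) ≤ 1} := by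
      ext z; simp [and_comm]
    rw [himg, Subtype.val_injective.encard_image] at h
    rw [← tsum_subtype]
    simp only [Pi.one_apply]
    rw [ENNReal.tsum_set_one]
    exact_mod_cast h
  calc _ ≤ ∑' l : Λ, ∑ c ∈ t, {l : Λ | dist (l : E2 d) (intVec x + c) ≤ 1}.indicator
          (1 : Λ → ℝ≥0∞) l := by
        refine ENNReal.tsum_le_tsum fun l => ?_
        by_cases hl : l ∈ (fun l : Λ => floorVec (l : E2 d)) ⁻¹' {x}
        swap
        · rw [Set.indicator_of_notMem hl]; exact zero_le
        rw [Set.indicator_of_mem hl]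
        replace hl : floorVec (l : E2 d) = x := hl
        have hmem := hcover (sub_floorVec_mem_unitCube (l : E2 d))
        simp only [Set.mem_iUnion, Finset.mem_coe, exists_prop] at hmem
        obtain ⟨c, hct, hc⟩ := hmem
        refine le_trans ?_ (Finset.single_le_sum (fun _ _ => zero_le) hct)
        rw [Set.indicator_of_mem]
        rw [Metric.mem_ball, hl, dist_eq_norm, sub_sub, ← dist_eq_norm] at hc
        exact hc.le
    _ = ∑ c ∈ t, ∑' l : Λ, {l : Λ | dist (l : E2 d) (intVec x + c) ≤ 1}.indicator
          (1 : Λ → ℝ≥0∞) l := Summable.tsum_finsetSum fun _ _ => ENNReal.summable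
    _ ≤ ∑ c ∈ t, (N : ℝ≥0∞) := Finset.sum_le_sum fun c _ => hball c
    _ = t.card * N := by simp

theorem IsWeight.nsmul_le_pow {v : E2 d → ℝ} (hv : IsWeight v) (z : E2 d) (n : ℕ) :
    v (((n + 1 : ℕ) : ℝ) • z) ≤ v z ^ (n + 1) := by
  induction n with
  | zero => simp
  | succ n ih =>
    have : (((n + 1 + 1 : ℕ) : ℝ) • z) = ((n + 1 : ℕ) : ℝ) • z + z := by
      push_cast; rw [add_smul _ (1 : ℝ), one_smul]
    rw [this, pow_succ]
    exact (hv.submul _ _).trans (mul_le_mul_of_nonneg_right ih (hv.pos z).le)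

theorem IsWeight.one_le {v : E2 d → ℝ} (hv : IsWeight v) (hGRS : SatisfiesGRS v) (z : E2 d) :
    1 ≤ v z := by
  refine le_of_tendsto (hGRS z) ?_
  filter_upwards [eventually_gt_atTop 0] with n hn
  obtain ⟨m, rfl⟩ := Nat.exists_eq_succ_of_ne_zero hn.ne'
  refine (Real.rpow_le_rpow (hv.pos _).le (hv.nsmul_le_pow z m) (by positivity)).trans_eq ?_
  exact Real.pow_rpow_inv_natCast (hv.pos z).le (by simp)

theorem IsWeight.exists_nsmul_le {v : E2 d → ℝ} (hv : IsWeight v) (hGRS : SatisfiesGRS v)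
    (z : E2 d) {q : ℝ} (hq : 1 < q) : ∃ C : ℝ, ∀ m : ℕ, v ((m : ℝ) • z) ≤ C * q ^ m := by
  have hev : ∀ᶠ n : ℕ in atTop, v ((n : ℝ) • z) ≤ q ^ n := by
    filter_upwards [(hGRS z).eventually_lt_const hq, eventually_gt_atTop 0] with n hn hn0
    have h := Real.rpow_le_rpow (Real.rpow_nonneg (hv.pos _).le _) hn.le (Nat.cast_nonneg n)
    rw [Real.rpow_natCast, Real.rpow_natCast] at h
    exact (Real.rpow_inv_natCast_pow (hv.pos _).le hn0.ne').symm.trans_le h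
  obtain ⟨M, hM⟩ := eventually_atTop.1 hev
  refine ⟨1 + ∑ m ∈ Finset.range M, v ((m : ℝ) • z), fun m => ?_⟩
  have hsum : 0 ≤ ∑ m ∈ Finset.range M, v ((m : ℝ) • z) :=
    Finset.sum_nonneg fun _ _ => (hv.pos _).le
  rcases lt_or_ge m M with h | h
  · refine le_trans ?_ (le_mul_of_one_le_right (by positivity) (one_le_pow₀ hq.le))
    have := Finset.single_le_sum (f := fun m : ℕ => v ((m : ℝ) • z))
      (fun _ _ => (hv.pos _).le) (Finset.mem_range.2 h)
    linarith
  · exact (hM m h).trans (le_mul_of_one_le_left (by positivity) (by linarith))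

/-- A tent function: equal to `1` on the unit ball of the sup norm, vanishing outside the ball of
radius `2`. -/
def tent (z : E2 d) : ℝ := max 0 (min 1 (2 - ‖WithLp.ofLp z‖))

theorem continuous_tent : Continuous (tent : E2 d → ℝ) := by
  unfold tent
  have := PiLp.continuous_ofLp 2 (fun _ : Fin d ⊕ Fin d => ℝ)
  fun_prop

theorem tent_nonneg (z : E2 d) : 0 ≤ tent z := le_max_left _ _

theorem tent_le_one (z : E2 d) : tent z ≤ 1 := max_le zero_le_one (min_le_left _ _)

theorem tent_eq_one {z : E2 d} (hz : ‖WithLp.ofLp z‖ ≤ 1) : tent z = 1 := by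
  rw [tent, min_eq_left (by linarith), max_eq_right zero_le_one]

theorem tent_eq_zero {z : E2 d} (hz : 2 ≤ ‖WithLp.ofLp z‖) : tent z = 0 :=
  max_eq_left ((min_le_right _ _).trans (by linarith))

theorem norm_ofLp_sub_sub_le (x y : E2 d) :
    ‖WithLp.ofLp (x - y - intVec (floorVec x - floorVec y))‖ ≤ 1 := by
  rw [pi_norm_le_iff_of_nonneg zero_le_one]
  intro i
  have h1 := Int.floor_le (x i)
  have h2 := Int.lt_floor_add_one (x i)
  have h3 := Int.floor_le (y i)
  have h4 := Int.lt_floor_add_one (y i)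
  rw [Real.norm_eq_abs, abs_le]
  simp only [intVec, floorVec, PiLp.sub_apply, Pi.sub_apply]
  push_cast
  constructor <;> linarith

theorem norm_ofLp_le_one {z : E2 d} (hz : z ∈ unitCube d) : ‖WithLp.ofLp z‖ ≤ 1 := by
  rw [pi_norm_le_iff_of_nonneg zero_le_one]
  intro i
  rw [Real.norm_of_nonneg (hz i).1]
  exact (hz i).2

theorem norm_ofLp_intVec (k : (Fin d ⊕ Fin d) → ℤ) : ‖WithLp.ofLp (intVec k)‖ = ‖k‖ := by
  simp only [intVec, Pi.norm_def]
  congr 2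

/-- A discrete summable envelope is dominated by an envelope in the amalgam space. -/
theorem exists_memAmalgamW {v : E2 d → ℝ} (hv : IsWeight v) (hv1 : ∀ z, 1 ≤ v z)
    {b : ((Fin d ⊕ Fin d) → ℤ) → ℝ≥0∞}
    (hb : ∑' k, b k * ENNReal.ofReal (v (intVec k)) ≠ ∞) :
    ∃ Θ : E2 d → ℝ, MemAmalgamW Θ v ∧
      ∀ x y : E2 d, (b (floorVec x - floorVec y)).toReal ≤ Θ (x - y) := by
  have hb1 : ∑' k, b k ≠ ∞ := ne_top_of_le_ne_top hb <| ENNReal.tsum_le_tsum fun k =>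
    le_mul_of_one_le_right' (ENNReal.one_le_ofReal.2 (hv1 _))
  have hbk : ∀ k, b k ≠ ∞ := ENNReal.ne_top_of_tsum_ne_top hb1
  have hbs := ENNReal.summable_toReal hb1
  have hle : ∀ z k, (b k).toReal * tent (z - intVec k) ≤ (b k).toReal := fun z k =>
    mul_le_of_le_one_right ENNReal.toReal_nonneg (tent_le_one _)
  have hnn : ∀ z k, 0 ≤ (b k).toReal * tent (z - intVec k) := fun z k =>
    mul_nonneg ENNReal.toReal_nonneg (tent_nonneg _)
  have hsum : ∀ z, Summable fun k => (b k).toReal * tent (z - intVec k) := fun z =>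
    hbs.of_nonneg_of_le (hnn z) (hle z)
  set Θ : E2 d → ℝ := fun z => ∑' k, (b k).toReal * tent (z - intVec k) with hΘ
  refine ⟨Θ, ⟨?_, ?_⟩, fun x y => ?_⟩
  · refine continuous_tsum (fun k => ?_) hbs fun k z => ?_
    · have := continuous_tent (d := d)
      fun_prop
    · rw [Real.norm_of_nonneg (hnn z k)]
      exact hle z k
  · have hspread := tsum_spread_ne_top (w := fun k => ENNReal.ofReal (v (intVec k)))
      (fun _ => ENNReal.ofReal_ne_top)
      (fun x y => by
        rw [← ENNReal.ofReal_mul (hv.pos _).le, intVec_add]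
        exact ENNReal.ofReal_le_ofReal (hv.submul _ _)) (φ := id) hb 3
    refine (ENNReal.summable_toReal hspread).of_nonneg_of_le
      (fun k => mul_nonneg (cubeSup_nonneg _ _) (hv.pos _).le) fun k => ?_
    rw [ENNReal.toReal_mul, ENNReal.toReal_ofReal (hv.pos _).le]
    refine mul_le_mul_of_nonneg_right ?_ (hv.pos _).le
    refine Real.sSup_le ?_ ENNReal.toReal_nonneg
    rintro _ ⟨z, hz, rfl⟩
    have hfin : ∀ i, (if ‖k - id i‖ ≤ 3 then b i else 0) ≠ ∞ := fun i => by
      split_ifs <;> simp [hbk]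
    simp only
    rw [Real.norm_of_nonneg (tsum_nonneg (hnn _)), ENNReal.tsum_toReal_eq hfin]
    refine (hsum _).tsum_le_tsum (fun i => ?_) (ENNReal.summable_toReal
      (ne_top_of_le_ne_top hb1 (ENNReal.tsum_le_tsum fun i => by split_ifs <;> simp)))
    split_ifs with hi
    · exact hle _ i
    · rw [tent_eq_zero, mul_zero, ENNReal.toReal_zero]
      have h1 : ‖k - i‖ ≤ ‖WithLp.ofLp (intVec k + z - intVec i)‖ + ‖WithLp.ofLp z‖ := by
        rw [← norm_ofLp_intVec]
        refine le_trans (le_of_eq ?_) (norm_sub_le _ _)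
        congr 1
        ext j
        simp [intVec]
        ring
      have h2 := norm_ofLp_le_one hz
      simp only [id, not_le] at hi
      linarith
  · have h := (hsum (x - y)).le_tsum (floorVec x - floorVec y) fun k _ => hnn _ k
    rwa [tent_eq_one (norm_ofLp_sub_sub_le x y), mul_one] at h

/-- Every bounded operator on `ℓ²` is represented by the matrix of its values at the standard
basis vectors. -/
theorem apply_eq_tsum_single {ι : Type*} [DecidableEq ι]
    (S : lp (fun _ : ι => ℂ) 2 →L[ℂ] lp (fun _ : ι => ℂ) 2) (c : lp (fun _ : ι => ℂ) 2) (l : ι) :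
    S c l = ∑' m, S (lp.single 2 m (1 : ℂ)) l * c m := by
  have h := ((lp.hasSum_single (p := 2) (by simp) c).mapL
    ((lp.evalCLM ℂ (fun _ : ι => ℂ) 2 l).comp S))
  refine h.tsum_eq.symm.trans (tsum_congr fun m => ?_)
  have hm : lp.single 2 m (c m) = c m • (lp.single 2 m (1 : ℂ) : lp (fun _ : ι => ℂ) 2) := by
    rw [← lp.single_smul, smul_eq_mul, mul_one]
  rw [hm, map_smul, smul_eq_mul, mul_comm]
  rfl

end Euclidean

/-- **Theorem (spectral invariance of `C_v`).** If `A ∈ C_v(Λ)` is invertible as a bounded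
operator on `ℓ²(Λ)`, then its inverse is again represented by a matrix in `C_v(Λ)`. -/
theorem Cv_inverse_closed {d : ℕ} (Λ : Set (E2 d)) (hΛc : Λ.Countable)
    (hΛs : RelativelySeparated Λ) (v : E2 d → ℝ) (hv : IsWeight v) (hGRS : SatisfiesGRS v)
    (A : Λ → Λ → ℂ) (hA : MemCv A v)
    (T S : lp (fun _ : Λ => ℂ) 2 →L[ℂ] lp (fun _ : Λ => ℂ) 2)
    (hT : Represents T A)
    (hST : S.comp T = ContinuousLinearMap.id ℂ (lp (fun _ : Λ => ℂ) 2))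
    (hTS : T.comp S = ContinuousLinearMap.id ℂ (lp (fun _ : Λ => ℂ) 2)) :
    ∃ B : Λ → Λ → ℂ, MemCv B v ∧ Represents S B := by
  classical
  have hv1 := hv.one_le hGRS
  obtain ⟨Θ, ⟨hΘc, hΘs⟩, hAΘ⟩ := hA
  obtain ⟨N, hN, hp⟩ := fiber_floorVec_le hΛs
  have hw : ∀ x y : (Fin d ⊕ Fin d) → ℤ, ENNReal.ofReal (v (intVec (x + y))) ≤
      ENNReal.ofReal (v (intVec x)) * ENNReal.ofReal (v (intVec y)) := fun x y => by
    rw [← ENNReal.ofReal_mul (hv.pos _).le, intVec_add]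
    exact ENNReal.ofReal_le_ofReal (hv.submul _ _)
  have hΘw : ∑' k, ENNReal.ofReal (cubeSup Θ k) * ENNReal.ofReal (v (intVec k)) ≠ ∞ := by
    simp_rw [← ENNReal.ofReal_mul (cubeSup_nonneg Θ _)]
    exact hΘs.tsum_ofReal_ne_top
  have hθ := tsum_spread_ne_top (w := fun k => ENNReal.ofReal (v (intVec k)))
    (fun _ => ENNReal.ofReal_ne_top) hw (φ := id) hΘw 1
  obtain ⟨b, hb, hSb⟩ := exists_inverse_envelope hN hp (fun _ => ENNReal.ofReal_ne_top)
    (fun _ => ENNReal.one_le_ofReal.2 (hv1 _)) hw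
    (fun s q hq hq' => by
      have hq1 : 1 < q.toReal := by simpa using ENNReal.toReal_strict_mono hq' hq
      obtain ⟨C, hC⟩ := hv.exists_nsmul_le hGRS (intVec s) hq1
      refine ⟨ENNReal.ofReal C, ENNReal.ofReal_ne_top, fun m => ?_⟩
      rw [intVec_nsmul]
      refine (ENNReal.ofReal_le_ofReal (hC m)).trans_eq ?_
      rw [ENNReal.ofReal_mul' (by positivity), ENNReal.ofReal_pow (by positivity),
        ENNReal.ofReal_toReal hq'])
    hθ (A := A)
    (fun l m => by
      refine le_trans ?_ (ENNReal.le_tsum (floorVec ((l : E2 d) - (m : E2 d))))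
      rw [id, if_pos (norm_floorVec_sub_le _ _), ← ofReal_norm]
      exact ENNReal.ofReal_le_ofReal ((hAΘ l m).trans (le_cubeSup hΘc _)))
    hT (fun c => DFunLike.congr_fun hST c) (fun c => DFunLike.congr_fun hTS c)
  obtain ⟨Θ', hΘ', hbΘ'⟩ := exists_memAmalgamW hv hv1 hb
  have hbk : ∀ k, b k ≠ ∞ := fun k => ne_top_of_le_ne_top (ENNReal.ne_top_of_tsum_ne_top hb k)
    (le_mul_of_one_le_right' (ENNReal.one_le_ofReal.2 (hv1 _)))
  refine ⟨fun l m => S (lp.single 2 m (1 : ℂ)) l, ⟨Θ', hΘ', fun l m => ?_⟩,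
    fun c l => apply_eq_tsum_single S c l⟩
  refine le_trans ?_ (hbΘ' l m)
  rw [← toReal_enorm]
  exact ENNReal.toReal_mono (hbk _) (hSb l m)
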